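/- arXiv:1007.2390 — 4 statements merged into one kernel-verified Lean document; each statement's English description precedes it below -/
import Mathlib

section
/- Let Q : W → V be a quadratic map of 𝔽₂-vector spaces with associated bilinear map B, and let f : W × W → V be an 𝔽₂-bilinear map with f(w,w) = Q(w) for all w ∈ W. Then the set V × W with multiplication (v,w)(v',w') = (v+v'+f(w,w'), w+w') is a group with identity (0,0); the subset V × {0} is a central subgroup isomorphic to V and the quotient by it is isomorphic to W; every element satisfies (v,w)² = (Q(w),0); and the commutator of any two elements satisfies [(v,w),(v',w')] = (B(w,w'),0). In particular this realizes any quadratic map Q as the squaring map of a central extension 0 → V → G(f) → W → 0 of elementary abelian 2-groups. -/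
/-- A quadratic map between `𝔽₂`-vector spaces. -/
def IsQuadraticMap {W V : Type*} [AddCommGroup W] [Module (ZMod 2) W]
    [AddCommGroup V] [Module (ZMod 2) V]
    (Q : W → V) (B : W →ₗ[ZMod 2] W →ₗ[ZMod 2] V) : Prop :=
  Q 0 = 0 ∧ ∀ w w' : W, B w w' = Q (w + w') + Q w + Q w'

/-- The multiplication `(v,w)(v',w') = (v + v' + f(w,w'), w + w')` on `V × W` determined by a
bilinear factor set `f`. -/
def gmul {W V : Type*} [AddCommGroup W] [Module (ZMod 2) W]
    [AddCommGroup V] [Module (ZMod 2) V]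
    (f : W →ₗ[ZMod 2] W →ₗ[ZMod 2] V) (p q : V × W) : V × W :=
  (p.1 + q.1 + f p.2 q.2, p.2 + q.2)

/-- given a quadratic map `Q` with associated bilinear map `B` and a bilinear
factor set `f` with `f w w = Q w`, the set `V × W` with multiplication `gmul f` is a group
with identity `(0,0)`; `V × {0}` is a central subgroup isomorphic to `V` with quotient `W`
(the second projection is multiplicative and surjective with kernel `V × {0}`); every element
satisfies `(v,w)² = (Q w, 0)`; and commutators satisfy `[(v,w),(v',w')] = (B w w', 0)`.
Hence any quadratic map is realized as the squaring map of a central extension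
`0 → V → G(f) → W → 0` of elementary abelian `2`-groups. -/
theorem statement2 {W V : Type*} [AddCommGroup W] [Module (ZMod 2) W]
    [AddCommGroup V] [Module (ZMod 2) V]
    (Q : W → V) (B : W →ₗ[ZMod 2] W →ₗ[ZMod 2] V)
    (hQ : IsQuadraticMap Q B)
    (f : W →ₗ[ZMod 2] W →ₗ[ZMod 2] V) (hf : ∀ w : W, f w w = Q w) :
    -- group structure
    (∀ a b c : V × W, gmul f (gmul f a b) c = gmul f a (gmul f b c)) ∧
    (∀ a : V × W, gmul f ((0 : V), (0 : W)) a = a) ∧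
    (∀ a : V × W, gmul f a ((0 : V), (0 : W)) = a) ∧
    (∀ a : V × W, ∃ b : V × W,
      gmul f a b = ((0 : V), (0 : W)) ∧ gmul f b a = ((0 : V), (0 : W))) ∧
    -- V × {0} is central and isomorphic to V
    (∀ (v : V) (a : V × W), gmul f (v, (0 : W)) a = gmul f a (v, (0 : W))) ∧
    (∀ v v' : V, gmul f (v, (0 : W)) (v', (0 : W)) = (v + v', (0 : W))) ∧
    -- the projection onto W is multiplicative and surjective with kernel V × {0}
    (∀ a b : V × W, (gmul f a b).2 = a.2 + b.2) ∧
    (∀ w : W, ∃ a : V × W, a.2 = w) ∧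
    (∀ a : V × W, a.2 = 0 ↔ ∃ v : V, a = (v, (0 : W))) ∧
    -- squares and commutators
    (∀ a : V × W, gmul f a a = (Q a.2, (0 : W))) ∧
    (∀ a b a' b' : V × W,
      gmul f a a' = ((0 : V), (0 : W)) → gmul f b b' = ((0 : V), (0 : W)) →
      gmul f (gmul f (gmul f a' b') a) b = (B a.2 b.2, (0 : W))) := by
  have hW : ∀ w : W, w + w = 0 := ZModModule.add_self
  have hV : ∀ v : V, v + v = 0 := ZModModule.add_self
  refine ⟨fun a b c => ?_, fun a => ?_, fun a => ?_, fun a => ?_, fun v a => ?_, fun v v' => ?_,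
    fun a b => rfl, fun w => ⟨(0, w), rfl⟩, fun a => ?_, fun a => ?_, fun a b a' b' ha hb => ?_⟩
  · ext
    · simp only [gmul, map_add, LinearMap.add_apply]
      abel
    · exact add_assoc _ _ _
  · simp [gmul]
  · simp [gmul]
  · refine ⟨(-a.1 + f a.2 a.2, -a.2), ?_, ?_⟩ <;> simp [gmul]
  · simp [gmul, add_comm]
  · simp [gmul]
  · exact ⟨fun h => ⟨a.1, Prod.ext rfl h⟩, fun ⟨v, h⟩ => h ▸ rfl⟩
  · simp [gmul, hV, hW, hf]
  · obtain ⟨v, w⟩ := a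
    obtain ⟨x, y⟩ := b
    obtain ⟨v', w'⟩ := a'
    obtain ⟨x', y'⟩ := b'
    simp only [gmul, Prod.mk.injEq] at ha hb ⊢
    obtain ⟨ha, hw⟩ := ha
    obtain ⟨hb, hy⟩ := hb
    obtain rfl : w' = -w := eq_neg_of_add_eq_zero_right hw
    obtain rfl : y' = -y := eq_neg_of_add_eq_zero_right hy
    simp only [map_neg] at ha hb
    obtain rfl : v' = f w w - v := by
      rw [← sub_eq_zero, ← ha]; abel
    obtain rfl : x' = f y y - x := by
      rw [← sub_eq_zero, ← hb]; abel
    refine ⟨?_, by abel⟩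
    rw [hQ.2, ← hf, ← hf, ← hf]
    simp only [map_add, map_neg, LinearMap.add_apply, LinearMap.neg_apply]
    linear_combination (norm := abel) -hV (f w w) - hV (f y w) - hV (f y y)
end

section
/- Let Q : W → V be a quadratic map of 𝔽₂-vector spaces with W finite-dimensional, and let f, f' : W × W → V both be 𝔽₂-bilinear maps with f(w,w) = f'(w,w) = Q(w) for all w ∈ W. Then there exists a function t : W → V such that f(w,w') + f'(w,w') = t(w) + t(w') + t(w+w') for all w,w' ∈ W, and consequently the map (v,w) ↦ (v + t(w), w) is a group isomorphism from G(f) to G(f') which is the identity on V × {0} and induces the identity on the quotient W. In particular, the central extension 0 → V → G(Q) → W → 0 with a bilinear factor set whose diagonal is Q is unique up to equivalence of extensions. -/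
/-- On a module with a basis, every alternating bilinear map is the skew-symmetrization of a
bilinear map. -/
theorem LinearMap.IsAlt.exists_sub_flip_eq {R M N ι : Type*} [CommRing R] [AddCommGroup M]
    [Module R M] [AddCommGroup N] [Module R N] {g : M →ₗ[R] M →ₗ[R] N} (hg : g.IsAlt)
    (b : Module.Basis ι R M) : ∃ h : M →ₗ[R] M →ₗ[R] N, h - h.flip = g := by
  classical
  let : LinearOrder ι := linearOrderOfSTO WellOrderingRel
  refine ⟨b.constr R fun i => b.constr R fun j => if i < j then g (b i) (b j) else 0, ?_⟩
  refine b.ext fun i => b.ext fun j => ?_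
  rcases lt_trichotomy i j with hij | rfl | hij
  · simp [Module.Basis.constr_basis, hij, hij.not_gt]
  · simp [Module.Basis.constr_basis, hg.self_eq_zero]
  · simp [Module.Basis.constr_basis, hij, hij.not_gt, hg.neg]

/-- Two bilinear maps of `𝔽₂`-vector spaces with the same diagonal differ by a coboundary. -/
theorem exists_coboundary_of_diagonal_eq {W V : Type*} [AddCommGroup W] [Module (ZMod 2) W]
    [AddCommGroup V] [Module (ZMod 2) V] (f f' : W →ₗ[ZMod 2] W →ₗ[ZMod 2] V)
    (hff' : ∀ w : W, f w w = f' w w) :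
    ∃ t : W → V, t 0 = 0 ∧ ∀ w w' : W, f w w' + f' w w' = t w + t w' + t (w + w') := by
  have hg : (f - f').IsAlt := fun w => by simp [hff']
  obtain ⟨h, hh⟩ := hg.exists_sub_flip_eq (Module.Basis.ofVectorSpace (ZMod 2) W)
  refine ⟨fun w => h w w, by simp, fun w w' => ?_⟩
  have key : h w w' - h w' w = f w w' - f' w w' := by
    simpa using congr($hh w w')
  simp only [ZModModule.sub_eq_add] at key
  have hw := ZModModule.add_self (h w w)
  have hw' := ZModModule.add_self (h w' w')
  rw [← key]
  simp only [map_add, LinearMap.add_apply]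
  calc h w w' + h w' w
      = (h w w + h w w) + (h w' w' + h w' w') + (h w w' + h w' w) := by simp [hw, hw']
    _ = _ := by abel

/-- if `f` and `f'` are two bilinear factor sets with the same diagonal `Q`, then
`f + f'` is the coboundary of some `t : W → V`, and `(v,w) ↦ (v + t w, w)` is a group
isomorphism `G(f) ≃ G(f')` that is the identity on `V × {0}` and induces the identity on the
quotient `W`; hence the central extension `0 → V → G(Q) → W → 0` with bilinear factor set
having diagonal `Q` is unique up to equivalence of extensions. -/
theorem statement3 {W V : Type*} [AddCommGroup W] [Module (ZMod 2) W]
    [AddCommGroup V] [Module (ZMod 2) V] [FiniteDimensional (ZMod 2) W]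
    (Q : W → V) (B : W →ₗ[ZMod 2] W →ₗ[ZMod 2] V)
    (hQ : IsQuadraticMap Q B)
    (f f' : W →ₗ[ZMod 2] W →ₗ[ZMod 2] V)
    (hf : ∀ w : W, f w w = Q w) (hf' : ∀ w : W, f' w w = Q w) :
    ∃ t : W → V,
      (∀ w w' : W, f w w' + f' w w' = t w + t w' + t (w + w')) ∧
      Function.Bijective (fun p : V × W => ((p.1 + t p.2, p.2) : V × W)) ∧
      (∀ p q : V × W,
        ((gmul f p q).1 + t (gmul f p q).2, (gmul f p q).2)
          = gmul f' (p.1 + t p.2, p.2) (q.1 + t q.2, q.2)) ∧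
      (∀ v : V, ((v + t (0 : W), (0 : W)) : V × W) = (v, (0 : W))) ∧
      (∀ p : V × W, ((p.1 + t p.2, p.2) : V × W).2 = p.2) := by
  obtain ⟨t, ht0, ht⟩ := exists_coboundary_of_diagonal_eq f f' fun w => (hf w).trans (hf' w).symm
  refine ⟨t, ht, ?_, fun p q => ?_, fun v => by simp [ht0], fun _ => rfl⟩
  · refine Function.Involutive.bijective fun p => ?_
    simp [add_assoc, ZModModule.add_self]
  · refine Prod.ext ?_ rfl
    have hsum : f p.2 q.2 + t (p.2 + q.2) = t p.2 + t q.2 + f' p.2 q.2 := by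
      rw [← sub_eq_zero, ZModModule.sub_eq_add]
      calc f p.2 q.2 + t (p.2 + q.2) + (t p.2 + t q.2 + f' p.2 q.2)
          = (f p.2 q.2 + f' p.2 q.2) + (t p.2 + t q.2 + t (p.2 + q.2)) := by abel
        _ = 0 := by rw [ht, ZModModule.add_self]
    simp only [gmul]
    rw [add_assoc, hsum]
    abel
end

section
/- Let Q₁ : W₁ → V₁ and Q₂ : W₂ → V₂ be quadratic maps of 𝔽₂-vector spaces with W₁ finite-dimensional, and let (f_W, f_V) be a morphism of quadratic maps, i.e. linear maps f_W : W₁ → W₂ and f_V : V₁ → V₂ with Q₂ ∘ f_W = f_V ∘ Q₁. Let f₁ : W₁ × W₁ → V₁ and f₂ : W₂ × W₂ → V₂ be 𝔽₂-bilinear maps with fᵢ(w,w) = Qᵢ(w) for all w, and let G(f₁), G(f₂) be the associated groups. Then there exists a function t : W₁ → V₂ such that the map f_G : G(f₁) → G(f₂) defined by f_G(v,w) = (f_V(v) + t(w), f_W(w)) is a group homomorphism; moreover f_G restricts to f_V on V₁ × {0} and induces f_W on the quotients W₁ → W₂. -/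
/-- An alternating bilinear map on a free module is the antisymmetrization of a bilinear map. -/
theorem LinearMap.IsAlt.exists_eq_sub_flip {R M N ι : Type*} [CommRing R]
    [AddCommGroup M] [Module R M] [AddCommGroup N] [Module R N] [LinearOrder ι]
    (b : Module.Basis ι R M) {g : M →ₗ[R] M →ₗ[R] N} (hg : g.IsAlt) :
    ∃ h : M →ₗ[R] M →ₗ[R] N, g = h - h.flip := by
  refine ⟨b.constr R fun i => b.constr R fun j => if i < j then g (b i) (b j) else 0,
    b.ext fun i => b.ext fun j => ?_⟩
  simp only [LinearMap.sub_apply, LinearMap.flip_apply, Module.Basis.constr_basis]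
  rcases lt_trichotomy i j with hij | rfl | hij
  · simp [hij, hij.not_gt]
  · simp [hg.self_eq_zero]
  · simp [hij, hij.not_gt, hg.neg]


/-- a morphism `(f_W, f_V)` of quadratic maps `Q₁ → Q₂` (with `W₁` finite
dimensional) can be realized on the associated groups: there is `t : W₁ → V₂` such that
`f_G (v, w) = (f_V v + t w, f_W w)` is a homomorphism `G(f₁) → G(f₂)`; it restricts to `f_V`
on `V₁ × {0}` and induces `f_W` on the quotients. -/
theorem statement4 {W₁ V₁ W₂ V₂ : Type*}
    [AddCommGroup W₁] [Module (ZMod 2) W₁] [AddCommGroup V₁] [Module (ZMod 2) V₁]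
    [AddCommGroup W₂] [Module (ZMod 2) W₂] [AddCommGroup V₂] [Module (ZMod 2) V₂]
    [FiniteDimensional (ZMod 2) W₁]
    (Q₁ : W₁ → V₁) (B₁ : W₁ →ₗ[ZMod 2] W₁ →ₗ[ZMod 2] V₁) (hQ₁ : IsQuadraticMap Q₁ B₁)
    (Q₂ : W₂ → V₂) (B₂ : W₂ →ₗ[ZMod 2] W₂ →ₗ[ZMod 2] V₂) (hQ₂ : IsQuadraticMap Q₂ B₂)
    (fW : W₁ →ₗ[ZMod 2] W₂) (fV : V₁ →ₗ[ZMod 2] V₂)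
    (hmor : ∀ w : W₁, Q₂ (fW w) = fV (Q₁ w))
    (f₁ : W₁ →ₗ[ZMod 2] W₁ →ₗ[ZMod 2] V₁) (hf₁ : ∀ w, f₁ w w = Q₁ w)
    (f₂ : W₂ →ₗ[ZMod 2] W₂ →ₗ[ZMod 2] V₂) (hf₂ : ∀ w, f₂ w w = Q₂ w) :
    ∃ t : W₁ → V₂,
      (∀ p q : V₁ × W₁,
        ((fV (gmul f₁ p q).1 + t (gmul f₁ p q).2, fW (gmul f₁ p q).2) : V₂ × W₂)
          = gmul f₂ (fV p.1 + t p.2, fW p.2) (fV q.1 + t q.2, fW q.2)) ∧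
      (∀ v : V₁, ((fV v + t (0 : W₁), fW (0 : W₁)) : V₂ × W₂) = (fV v, (0 : W₂))) ∧
      (∀ p : V₁ × W₁, ((fV p.1 + t p.2, fW p.2) : V₂ × W₂).2 = fW p.2) := by
  have double (x : V₂) : x + x = 0 := ZModModule.add_self x
  have hg : (f₁.compr₂ fV - f₂.compl₁₂ fW fW).IsAlt := fun w => by
    simp [hf₁, hf₂, hmor]
  obtain ⟨h, hh⟩ := hg.exists_eq_sub_flip (Module.finBasis (ZMod 2) W₁)
  have key (w w' : W₁) : fV (f₁ w w') = f₂ (fW w) (fW w') + (h w w' + h w' w) := by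
    have := LinearMap.congr_fun₂ hh w w'
    simp only [LinearMap.sub_apply, LinearMap.compr₂_apply, LinearMap.compl₁₂_apply,
      LinearMap.flip_apply] at this
    rw [sub_eq_iff_eq_add'.mp this, ZModModule.sub_eq_add]
  refine ⟨fun w => h w w, fun p q => Prod.ext ?_ (map_add fW _ _), fun v => by simp, fun p => rfl⟩
  simp only [gmul, map_add, LinearMap.add_apply, key]
  have h₁ := double (h p.2 q.2)
  have h₂ := double (h q.2 p.2)
  linear_combination (norm := module) h₁ + h₂
end

section
/- Let q₁,…,qₙ ∈ 𝔽₂[x₁,…,x_m] be homogeneous polynomials of degree 2, written as a column vector q, and let L be an n×n matrix whose entries are homogeneous linear forms such that β(q) = Lq (entrywise). Then (β(L) + L²)·q = 0, where β is applied to L entrywise. Moreover, if q₁,…,qₙ are algebraically independent over 𝔽₂ and T₁,…,Tₙ are n×n matrices with entries in 𝔽₂ satisfying β(L) + L² = Σᵢ Tᵢ qᵢ, then for all indices i, j, k one has Tᵢ(k,i) = 0 and Tᵢ(k,j) = Tⱼ(k,i). -/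
open MvPolynomial

/-- The Bockstein operator. -/
noncomputable def bockstein {σ : Type*} [Fintype σ]
    (p : MvPolynomial σ (ZMod 2)) : MvPolynomial σ (ZMod 2) :=
  ∑ i, X i ^ 2 * pderiv i p

/-- The Bockstein operator as a derivation. -/
noncomputable def bocksteinDerivation (σ : Type*) [Fintype σ] :
    Derivation (ZMod 2) (MvPolynomial σ (ZMod 2)) (MvPolynomial σ (ZMod 2)) :=
  ∑ i, (X i ^ 2 : MvPolynomial σ (ZMod 2)) • pderiv i

theorem bocksteinDerivation_apply {σ : Type*} [Fintype σ] (p : MvPolynomial σ (ZMod 2)) :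
    bocksteinDerivation σ p = bockstein p := by
  let evalAt : Derivation (ZMod 2) (MvPolynomial σ (ZMod 2)) (MvPolynomial σ (ZMod 2)) →+
      MvPolynomial σ (ZMod 2) :=
    { toFun := fun D => D p
      map_zero' := rfl
      map_add' := fun _ _ => rfl }
  exact map_sum evalAt _ _

theorem bocksteinDerivation_X {σ : Type*} [Fintype σ] (i : σ) :
    bocksteinDerivation σ (X i) = X i ^ 2 := by
  classical
  simp [bocksteinDerivation_apply, bockstein, pderiv_X, Pi.single_apply]

theorem bocksteinDerivation_bocksteinDerivation {σ : Type*} [Fintype σ]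
    (p : MvPolynomial σ (ZMod 2)) : bocksteinDerivation σ (bocksteinDerivation σ p) = 0 := by
  induction p using MvPolynomial.induction_on with
  | C a => simp
  | add p q hp hq => simp [hp, hq]
  | mul_X p i hp =>
    simp only [Derivation.leibniz, map_add, smul_eq_mul, bocksteinDerivation_X, hp, pow_two]
    linear_combination
      (p * X i ^ 3 + X i ^ 2 * bocksteinDerivation σ p) *
        CharTwo.two_eq_zero (R := MvPolynomial σ (ZMod 2))

/-- Over `𝔽₂`, a quadratic form vanishing at algebraically independent elements has an
alternating coefficient matrix. -/
theorem AlgebraicIndependent.alternating_of_sum_eq_zero {ι A : Type*} [Fintype ι] [CommRing A]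
    [Algebra (ZMod 2) A] {q : ι → A} (hq : AlgebraicIndependent (ZMod 2) q)
    {M : ι → ι → ZMod 2} (h : ∑ j, ∑ i, algebraMap (ZMod 2) A (M i j) * q i * q j = 0) :
    (∀ i, M i i = 0) ∧ ∀ i j, M i j = M j i := by
  classical
  have hP : (∑ j, ∑ i, C (M i j) * X i * X j : MvPolynomial ι (ZMod 2)) = 0 := by
    apply hq
    simpa using h
  have heval (v : ι → ZMod 2) : ∑ j, ∑ i, M i j * v i * v j = 0 := by
    simpa using congrArg (eval v) hP
  have hdiag (i : ι) : M i i = 0 := by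
    simpa [Pi.single_apply] using heval (Pi.single i 1)
  refine ⟨hdiag, fun i j => ?_⟩
  have hij := heval (Pi.single i 1 + Pi.single j 1)
  simp [Pi.single_apply, mul_add, Finset.sum_add_distrib, hdiag] at hij
  exact CharTwo.add_eq_zero.mp ((add_comm _ _).trans hij)


/-- STATEMENT 19: if `q` is a column of homogeneous quadrics with `β(q) = Lq` for a matrix `L`
of homogeneous linear forms, then `(β(L) + L²)q = 0`; and if moreover the `qᵢ` are
algebraically independent and `T₁,…,Tₙ` are scalar matrices with `β(L) + L² = Σᵢ Tᵢ qᵢ`, then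
`Tᵢ(k,i) = 0` and `Tᵢ(k,j) = Tⱼ(k,i)` for all `i, j, k`. -/
theorem statement19 {m n : ℕ}
    (q : Fin n → MvPolynomial (Fin m) (ZMod 2))
    (hq : ∀ k, (q k).IsHomogeneous 2)
    (L : Fin n → Fin n → MvPolynomial (Fin m) (ZMod 2))
    (hL : ∀ k j, (L k j).IsHomogeneous 1)
    (hLq : ∀ k, bockstein (q k) = ∑ j, L k j * q j) :
    (∀ k : Fin n,
      ∑ j, (bockstein (L k j) + ∑ c, L k c * L c j) * q j = 0) ∧
    (AlgebraicIndependent (ZMod 2) q →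
      ∀ T : Fin n → Matrix (Fin n) (Fin n) (ZMod 2),
        (∀ k j, bockstein (L k j) + ∑ c, L k c * L c j = ∑ i, C (T i k j) * q i) →
        (∀ i k, T i k i = 0) ∧ (∀ i j k, T i k j = T j k i)) := by
  have hrel (k : Fin n) :
      ∑ j, (bockstein (L k j) + ∑ c, L k c * L c j) * q j = 0 := by
    have h := bocksteinDerivation_bocksteinDerivation (q k)
    rw [bocksteinDerivation_apply (q k), hLq, map_sum] at h
    simp only [Derivation.leibniz, smul_eq_mul, bocksteinDerivation_apply, hLq,
      Finset.sum_add_distrib, Finset.mul_sum] at h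
    simp only [add_mul, Finset.sum_add_distrib, Finset.sum_mul]
    rw [Finset.sum_comm, add_comm] at h
    simpa only [mul_comm (q _), mul_assoc] using h
  refine ⟨hrel, fun hind T hT => ?_⟩
  have halt (k : Fin n) := hind.alternating_of_sum_eq_zero (M := fun i j => T i k j) (by
    simpa only [hT, Finset.sum_mul, algebraMap_eq] using hrel k)
  exact ⟨fun i k => (halt k).1 i, fun i j k => (halt k).2 i j⟩
end
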